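/- Let G be a finite simple graph on n ≥ 3 vertices with no isolated vertices, and suppose t(G) = t(1, n) + 1. Then t(G + {x}) = t(G) + 1 = t(1, n) + 2, where G + {x} is the graph obtained from G by adding one new universal vertex. -/

import Mathlib

open Finset

/-- A `d`-cover-free family `d`-CFF(t,n): for all pairwise distinct indices
`i₀, i₁, …, i_d`, the block `B i₀` is not contained in the union of the `d` others. -/
def IsCFF (d t n : ℕ) (B : Fin n → Finset (Fin t)) : Prop :=
  ∀ (i₀ : Fin n) (S : Finset (Fin n)), S.card = d → i₀ ∉ S →
    ¬ B i₀ ⊆ S.biUnion B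

/-- `t(d,n)`: the least `t` for which a `d`-CFF(t,n) exists. -/
noncomputable def tCFF (d n : ℕ) : ℕ :=
  sInf {t | ∃ B : Fin n → Finset (Fin t), IsCFF d t n B}

/-- The set system `B` is Sperner for the pair `a, b`. -/
def SpernerFor {V : Type*} {t : ℕ} (B : V → Finset (Fin t)) (a b : V) : Prop :=
  (B a \ B b).Nonempty ∧ (B b \ B a).Nonempty

/-- `B` is a `G`-Sperner set system. -/
def IsGSperner {V : Type*} (G : SimpleGraph V) {t : ℕ} (B : V → Finset (Fin t)) : Prop :=
  ∀ a b, G.Adj a b → SpernerFor B a b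

/-- The set system `B` is cover-free for the pair `a, b`. -/
def CoverFreeFor {V : Type*} {t : ℕ} (B : V → Finset (Fin t)) (a b : V) : Prop :=
  ∀ c, c ≠ a → c ≠ b → (B c \ (B a ∪ B b)).Nonempty

/-- `B` is a `G`-ECFF: cover-free for every edge of `G`. -/
def IsGECFF {V : Type*} (G : SimpleGraph V) {t : ℕ} (B : V → Finset (Fin t)) : Prop :=
  ∀ a b, G.Adj a b → CoverFreeFor B a b

/-- `B` is a `G`-CFF: a `G`-ECFF that is also `G`-Sperner. -/
def IsGCFF {V : Type*} (G : SimpleGraph V) {t : ℕ} (B : V → Finset (Fin t)) : Prop :=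
  IsGECFF G B ∧ IsGSperner G B

/-- `t_s(G)`: least `t` admitting a `G`-Sperner set system. -/
noncomputable def tS {V : Type*} (G : SimpleGraph V) : ℕ :=
  sInf {t | ∃ B : V → Finset (Fin t), IsGSperner G B}

/-- `t_e(G)`: least `t` admitting a `G`-ECFF set system. -/
noncomputable def tE {V : Type*} (G : SimpleGraph V) : ℕ :=
  sInf {t | ∃ B : V → Finset (Fin t), IsGECFF G B}

/-- `t(G)`: least `t` admitting a `G`-CFF set system. -/
noncomputable def tG {V : Type*} (G : SimpleGraph V) : ℕ :=
  sInf {t | ∃ B : V → Finset (Fin t), IsGCFF G B}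

/-- `G + {x}`: the graph `G` together with a new universal vertex (`none`). -/
def addUniversal {V : Type*} (G : SimpleGraph V) : SimpleGraph (Option V) where
  Adj a b :=
    match a, b with
    | some u, some v => G.Adj u v
    | some _, none => True
    | none, some _ => True
    | none, none => False
  symm := by
    refine ⟨?_⟩
    rintro (_ | u) (_ | v) h
    · exact h.elim
    · trivial
    · trivial
    · exact G.adj_symm h
  loopless := by
    refine ⟨?_⟩
    rintro (_ | u) h
    · exact h
    · exact G.loopless.irrefl u h

lemma exists_restrict {t : ℕ} (P : Finset (Fin t)) :
    ∃ e : Fin (t - P.card) → Fin t, (∀ j, j ∉ P → ∃ i, e i = j) := by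
  have h : (Pᶜ).card = t - P.card := by rw [Finset.card_compl, Fintype.card_fin]
  refine ⟨(Pᶜ).orderEmbOfFin h, fun j hj => ?_⟩
  have : j ∈ Set.range ((Pᶜ).orderEmbOfFin h) := by
    rw [Finset.range_orderEmbOfFin]; simpa using hj
  exact this

lemma tG_upper {V : Type*} (G : SimpleGraph V) (hiso : ∀ v : V, ∃ u, G.Adj v u) {t : ℕ}
    (B : V → Finset (Fin t)) (hB : IsGCFF G B) :
    ∃ B' : Option V → Finset (Fin (t+1)), IsGCFF (addUniversal G) B' := by
  obtain ⟨hE, hS⟩ := hB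
  have hne : ∀ c v, c ≠ v → (B c \ B v).Nonempty := by
    intro c v hcv
    obtain ⟨u, hu⟩ := hiso v
    by_cases h : c = u
    · subst h; exact (hS _ _ hu).2
    · obtain ⟨x, hx⟩ := hE _ _ hu c hcv h
      exact ⟨x, by simp at hx ⊢; tauto⟩
  have hne0 : ∀ v, (B v).Nonempty := by
    intro v
    obtain ⟨u, hu⟩ := hiso v
    exact (hS _ _ hu).1.mono sdiff_subset
  let B' : Option V → Finset (Fin (t+1)) := fun o =>
    o.elim {Fin.last t} (fun v => (B v).map Fin.castSuccEmb)
  have m1 : ∀ v (i : Fin t), i.castSucc ∈ B' (some v) ↔ i ∈ B v := by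
    intro v i; simp [B']
  have m2 : ∀ v, Fin.last t ∉ B' (some v) := by
    intro v; simp [B']
  have m3 : ∀ i : Fin t, i.castSucc ∉ B' none := by
    intro i; simp [B', (Fin.castSucc_lt_last i).ne]
  have m4 : Fin.last t ∈ B' none := by simp [B']
  refine ⟨B', ?_, ?_⟩
  · rintro (_ | a) (_ | b) hab (_ | c) hca hcb
    · exact hab.elim
    · exact hab.elim
    · exact (hca rfl).elim
    · obtain ⟨x, hx⟩ := hne c b (by simpa using hcb)
      exact ⟨x.castSucc, by simp only [mem_sdiff, mem_union, m1, m3] at hx ⊢; tauto⟩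
    · exact (hcb rfl).elim
    · obtain ⟨x, hx⟩ := hne c a (by simpa using hca)
      exact ⟨x.castSucc, by simp only [mem_sdiff, mem_union, m1, m3] at hx ⊢; tauto⟩
    · exact ⟨Fin.last t, by simp only [mem_sdiff, mem_union, m2, m4]; tauto⟩
    · obtain ⟨x, hx⟩ := hE a b hab c (by simpa using hca) (by simpa using hcb)
      exact ⟨x.castSucc, by simp only [mem_sdiff, mem_union, m1] at hx ⊢; tauto⟩
  · have key : ∀ a, (B' none \ B' (some a)).Nonempty ∧ (B' (some a) \ B' none).Nonempty := by
      intro a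
      obtain ⟨x, hx⟩ := hne0 a
      exact ⟨⟨Fin.last t, by simp only [mem_sdiff, m2, m4]; tauto⟩,
        ⟨x.castSucc, by simp only [mem_sdiff, m1, m3]; tauto⟩⟩
    rintro (_ | a) (_ | b) hab
    · exact hab.elim
    · exact key b
    · exact (key a).symm
    · obtain ⟨⟨x, hx⟩, ⟨y, hy⟩⟩ := hS a b hab
      exact ⟨⟨x.castSucc, by simp only [mem_sdiff, m1] at hx ⊢; tauto⟩,
        ⟨y.castSucc, by simp only [mem_sdiff, m1] at hy ⊢; tauto⟩⟩

lemma tG_lower1 {V : Type*} [Fintype V] (G : SimpleGraph V)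
    (hiso : ∀ v : V, ∃ u, G.Adj v u) {t : ℕ}
    (B : Option V → Finset (Fin t)) (hB : IsGCFF (addUniversal G) B) :
    tCFF 1 (Fintype.card V) ≤ t - (B none).card := by
  obtain ⟨e, he⟩ := exists_restrict (B none)
  let f := (Fintype.equivFin V).symm
  refine Nat.sInf_le ⟨fun k => univ.filter (fun i => e i ∈ B (some (f k))), ?_⟩
  intro k S hS hk hsub
  obtain ⟨l, rfl⟩ := Finset.card_eq_one.1 hS
  have hkl : k ≠ l := by simpa using hk
  obtain ⟨j, hj⟩ := hB.1 none (some (f l)) trivial (some (f k)) (by simp) (by simpa using hkl)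
  simp only [mem_sdiff, mem_union, not_or] at hj
  obtain ⟨i, rfl⟩ := he j hj.2.1
  have := @hsub i (by simpa using hj.1)
  simp at this
  exact hj.2.2 this

lemma tG_lower2 {V : Type*} (G : SimpleGraph V)
    (hiso : ∀ v : V, ∃ u, G.Adj v u) {t : ℕ}
    (B : Option V → Finset (Fin t)) (hB : IsGCFF (addUniversal G) B)
    (h1 : (B none).card = 1) : tG G ≤ t - 1 := by
  obtain ⟨e, he⟩ := exists_restrict (B none)
  rw [← h1]
  obtain ⟨p, hp⟩ := Finset.card_eq_one.1 h1
  have hd : ∀ v j, j ∈ B (some v) → j ∉ B none := by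
    intro v j hj hj'
    obtain ⟨u, hu⟩ := hiso v
    obtain ⟨q, hq⟩ := hB.1 (some v) (some u) hu none (by simp) (by simp)
    simp only [hp, mem_sdiff, mem_union, not_or, mem_singleton] at hq hj'
    rw [hq.1, ← hj'] at hq
    exact hq.2.1 hj
  refine Nat.sInf_le ⟨fun v => univ.filter (fun i => e i ∈ B (some v)), ?_, ?_⟩
  · intro a b hab c hca hcb
    obtain ⟨j, hj⟩ := hB.1 (some a) (some b) hab (some c) (by simpa using hca) (by simpa using hcb)
    rw [mem_sdiff] at hj
    obtain ⟨i, rfl⟩ := he j (hd _ _ hj.1)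
    exact ⟨i, by simpa using hj⟩
  · intro a b hab
    obtain ⟨⟨j, hj⟩, ⟨k, hk⟩⟩ := hB.2 (some a) (some b) hab
    rw [mem_sdiff] at hj hk
    obtain ⟨i, rfl⟩ := he j (hd _ _ hj.1)
    obtain ⟨l, rfl⟩ := he k (hd _ _ hk.1)
    exact ⟨⟨i, by simpa using hj⟩, ⟨l, by simpa using hk⟩⟩

theorem stmt_13 {V : Type*} [Fintype V] (G : SimpleGraph V)
    (hn : 3 ≤ Fintype.card V) (hiso : ∀ v : V, ∃ u, G.Adj v u)
    (htG : tG G = tCFF 1 (Fintype.card V) + 1) :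
    tG (addUniversal G) = tG G + 1 ∧
      tG (addUniversal G) = tCFF 1 (Fintype.card V) + 2 := by
  obtain ⟨B, hB⟩ : ∃ B : V → Finset (Fin (tG G)), IsGCFF G B :=
    Nat.sInf_mem (Nat.nonempty_of_pos_sInf (s := {t | ∃ B : V → Finset (Fin t), IsGCFF G B})
      (by change 0 < tG G; omega))
  have hup := tG_upper G hiso B hB
  have hle : tG (addUniversal G) ≤ tG G + 1 := Nat.sInf_le hup
  obtain ⟨C, hC⟩ : ∃ C : Option V → Finset (Fin (tG (addUniversal G))),
      IsGCFF (addUniversal G) C :=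
    Nat.sInf_mem (s := {t | ∃ B : Option V → Finset (Fin t), IsGCFF (addUniversal G) B})
      ⟨_, hup⟩
  have l1 := tG_lower1 G hiso C hC
  have l2 := tG_lower2 G hiso C hC
  have hc : (C none).card ≤ tG (addUniversal G) := by
    simpa using Finset.card_le_univ (C none)
  have hpos : 0 < (C none).card := by
    obtain ⟨v⟩ : Nonempty V := Fintype.card_pos_iff.1 (by omega)
    exact Finset.card_pos.2 ((hC.2 none (some v) trivial).1.mono sdiff_subset)
  have : tG (addUniversal G) ≥ tG G + 1 := by
    by_cases h : (C none).card = 1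
    · have := l2 h
      omega
    · omega
  omega
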